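/- arXiv:1401.7289 — 4 statements merged into one kernel-verified Lean document; each statement's English description precedes it below -/
import Mathlib

section
/- For every integer l ≥ 3 and every ε with 0 ≤ ε < 1 - 3/l, every fixed point (x1, x2) ∈ [0,1]² of the density evolution of the (l,3,3) MacKay–Neal code on BEC(ε) other than (0,0) satisfies U(x1, x2; ε) > 0. (In particular, the potential threshold of the (l,3,3) MacKay–Neal code equals the Shannon limit 1 - 3/l.) -/
/-- Potential function of the `(l,3,3)` MacKay–Neal code on BEC(ε). -/
noncomputable def potMN (l : ℕ) (x1 x2 ε : ℝ) : ℝ :=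
  1 - ε * (1 - (1-x1)^3 * (1-x2)^2)^3
    - (3 / (l:ℝ)) * (1 - (1-x1)^2 * (1-x2)^3)^l
    - (1-x1)^3 * (1-x2)^3
    - 3 * x1 * (1-x1)^2 * (1-x2)^3
    - 3 * x2 * (1-x1)^3 * (1-x2)^2

/-- In the variables `a = 1 - x1`, `b = 1 - x2`, this polynomial times `a * b` is the lower bound for
the potential obtained by eliminating `ε` and `l`. Its Bernstein coefficients on the unit square are
nonnegative. -/
theorem one_sub_pow_eight_le_eliminant {a b : ℝ} (ha0 : 0 ≤ a) (ha1 : a ≤ 1)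
    (hb0 : 0 ≤ b) (hb1 : b ≤ 1) :
    (1 - a) ^ 8 ≤ 1 - 2 * a ^ 3 * b + b ^ 2 * (-3 * a + 2 * a ^ 2)
      + b ^ 3 * (a - a ^ 2 + 3 * a ^ 5 + a ^ 6) + b ^ 4 * (4 * a ^ 4 - 5 * a ^ 5)
      - 2 * a ^ 8 * b ^ 5 + b ^ 6 * (3 * a ^ 8 - 2 * a ^ 7) := by
  obtain ⟨s, rfl⟩ : ∃ s, a = 1 - s := ⟨1 - a, by ring⟩
  obtain ⟨t, rfl⟩ : ∃ t, b = 1 - t := ⟨1 - b, by ring⟩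
  have hs : 0 ≤ s := by linarith
  have ht : 0 ≤ t := by linarith
  have bernstein_nonneg : 0 ≤
      (1 - s) * s ^ 7 * (8 * t ^ 3 + 24 * (1 - t) * t ^ 2 + 21 * (1 - t) ^ 2 * t + 6 * (1 - t) ^ 3)
      + (1 - s) ^ 2 * s ^ 6 *
        (28 * t ^ 3 + 84 * (1 - t) * t ^ 2 + 65 * (1 - t) ^ 2 * t + 15 * (1 - t) ^ 3)
      + (1 - s) ^ 3 * s ^ 5 *
        (56 * t ^ 3 + 166 * (1 - t) * t ^ 2 + 113 * (1 - t) ^ 2 * t + 18 * (1 - t) ^ 3)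
      + (1 - s) ^ 4 * s ^ 4 *
        (70 * t ^ 4 + 270 * (1 - t) * t ^ 3 + 315 * (1 - t) ^ 2 * t ^ 2 + 120 * (1 - t) ^ 3 * t
          + 9 * (1 - t) ^ 4)
      + (1 - s) ^ 5 * s ^ 3 *
        (56 * t ^ 4 + 204 * (1 - t) * t ^ 3 + 211 * (1 - t) ^ 2 * t ^ 2 + 52 * (1 - t) ^ 3 * t)
      + (1 - s) ^ 6 * s ^ 2 *
        (28 * t ^ 4 + 92 * (1 - t) * t ^ 3 + 75 * (1 - t) ^ 2 * t ^ 2 + 2 * (1 - t) ^ 3 * t)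
      + (1 - s) ^ 7 * s *
        (8 * t ^ 6 + 38 * (1 - t) * t ^ 5 + 61 * (1 - t) ^ 2 * t ^ 4 + 36 * (1 - t) ^ 3 * t ^ 3
          + 3 * (1 - t) ^ 4 * t ^ 2)
      + (1 - s) ^ 8 * (t ^ 6 + 4 * (1 - t) * t ^ 5 + 4 * (1 - t) ^ 2 * t ^ 4) := by
    positivity
  linarith

/-- Every nonzero fixed point of the `(l,3,3)` MN density evolution on BEC(ε),
for `ε < 1 - 3/l`, has strictly positive potential. -/
theorem stmt0 (l : ℕ) (hl : 3 ≤ l) (ε : ℝ) (hε0 : 0 ≤ ε) (hε : ε < 1 - 3 / (l:ℝ))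
    (x1 x2 : ℝ) (hx1 : x1 ∈ Set.Icc (0:ℝ) 1) (hx2 : x2 ∈ Set.Icc (0:ℝ) 1)
    (hfix1 : x1 = (1 - (1-x1)^2 * (1-x2)^3)^(l-1))
    (hfix2 : x2 = ε * (1 - (1-x1)^3 * (1-x2)^2)^2)
    (hne : (x1, x2) ≠ (0, 0)) :
    0 < potMN l x1 x2 ε := by
  have hl0 : (0 : ℝ) < l := by positivity
  set c : ℝ := 3 / (l : ℝ) with hc
  have hc0 : 0 < c := by positivity
  obtain ⟨a, rfl⟩ : ∃ a, x1 = 1 - a := ⟨1 - x1, by ring⟩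
  obtain ⟨b, rfl⟩ : ∃ b, x2 = 1 - b := ⟨1 - x2, by ring⟩
  simp only [sub_sub_cancel] at hfix1 hfix2
  have ha0 : 0 ≤ a := by linarith [hx1.2]
  have ha1 : a ≤ 1 := by linarith [hx1.1]
  have hb0 : 0 ≤ b := by linarith [hx2.2]
  have hb1 : b ≤ 1 := by linarith [hx2.1]
  have hpot : potMN l (1 - a) (1 - b) ε =
      b - 2 * (1 - b) * a ^ 3 * b ^ 2 - a ^ 3 * b ^ 3 - (1 - a) * (1 + 2 * (a ^ 2 * b ^ 3))
        + (1 - a) * (1 - a ^ 2 * b ^ 3) * (1 - c) := by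
    have hpow : (1 - a ^ 2 * b ^ 3) ^ l = (1 - a) * (1 - a ^ 2 * b ^ 3) := by
      conv_lhs => rw [← Nat.sub_add_cancel (by omega : 1 ≤ l), pow_succ, ← hfix1]
    simp only [potMN, sub_sub_cancel, hpow, ← hc]
    linear_combination (1 - a ^ 3 * b ^ 2) * hfix2
  have ha_lt : a < 1 := by
    refine lt_of_le_of_ne ha1 fun h => hne ?_
    subst h
    have hb : 1 - 1 ^ 2 * b ^ 3 = 0 :=
      pow_eq_zero_iff (by omega : l - 1 ≠ 0) |>.1 (by linarith [hfix1])
    have hb : b ^ 3 = 1 := by linarith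
    rw [(pow_eq_one_iff_of_nonneg hb0 (by norm_num)).1 hb]
    norm_num
  have hb_pos : 0 < b := by
    refine lt_of_le_of_ne hb0 fun h => ?_
    subst h
    norm_num at hfix2
    linarith
  rw [hpot]
  rcases ha0.eq_or_lt with rfl | ha_pos
  · norm_num at hfix2 ⊢
    linarith
  have hp : 0 < 1 - a ^ 3 * b ^ 2 := by
    have : a ^ 3 * b ^ 2 < 1 := mul_lt_one_of_nonneg_of_lt_one_left (by positivity)
      (pow_lt_one₀ ha0 ha_lt (by norm_num)) (pow_le_one₀ hb0 hb1)
    linarith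
  have hw : 0 ≤ 1 - a ^ 2 * b ^ 3 := by
    have := mul_le_one₀ (pow_le_one₀ (n := 2) ha0 ha1) (by positivity)
      (pow_le_one₀ (n := 3) hb0 hb1)
    linarith
  have hεc : (1 - a) * (1 - a ^ 2 * b ^ 3) * ε ≤ (1 - a) * (1 - a ^ 2 * b ^ 3) * (1 - c) :=
    mul_le_mul_of_nonneg_left hε.le (mul_nonneg (by linarith) hw)
  refine lt_of_lt_of_le ?_ (add_le_add_right hεc _)
  refine pos_of_mul_pos_left ?_ (sq_nonneg (1 - a ^ 3 * b ^ 2))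
  have hH := (pow_pos (sub_pos.2 ha_lt) 8).trans_le
    (one_sub_pow_eight_le_eliminant ha0 ha1 hb0 hb1)
  refine (mul_pos (mul_pos ha_pos hb_pos) hH).trans_eq ?_
  linear_combination (1 - a) * (1 - a ^ 2 * b ^ 3) * hfix2
end

section
/- For every integer l ≥ 3 and every z ∈ (0,1), U(z) > 0. -/
open Real

/-- `U(z)` of the `(l,3,3)` MN codes (potential along the non-trivial fixed points,
parametrized by `x1 = z^(l-1)`). Fractional powers are real powers. -/
noncomputable def Uz (l : ℕ) (z : ℝ) : ℝ :=
  -(3 * z^l / (l:ℝ)) + (1-z) * (1 - 4 * z^(l-1))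
    + (1-z) ^ ((1:ℝ)/3) * (1 - z^(l-1)) ^ (-(2:ℝ)/3)
    - 2 * (1-z) ^ ((2:ℝ)/3) * (1 - z^(l-1)) ^ ((5:ℝ)/3)

/-- A quadratic with positive Bernstein coefficients on `[0, E]` is positive there. -/
theorem quadratic_pos_of_bernstein {E c₀ c₁ c₂ t : ℝ} (hE : 0 < E) (ht₀ : 0 ≤ t) (htE : t ≤ E)
    (h₀ : 0 < c₀) (h₁ : 0 < 2 * c₀ + E * c₁) (h₂ : 0 < c₀ + E * c₁ + E ^ 2 * c₂) :
    0 < c₀ + c₁ * t + c₂ * t ^ 2 := by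
  have e : E ^ 2 * (c₀ + c₁ * t + c₂ * t ^ 2) = c₀ * (E - t) ^ 2 +
      (2 * c₀ + E * c₁) * (t * (E - t)) + (c₀ + E * c₁ + E ^ 2 * c₂) * t ^ 2 := by ring
  have hs : 0 ≤ E - t := sub_nonneg.2 htE
  refine pos_of_mul_pos_right (a := E ^ 2) ?_ (by positivity)
  rw [e]
  rcases ht₀.eq_or_lt with rfl | ht
  · simp only [sub_zero, zero_mul, mul_zero, add_zero, ne_eq, OfNat.ofNat_ne_zero,
      not_false_eq_true, zero_pow]
    positivity
  · positivity

theorem potential_pos_of_le {a b r : ℝ} (ha₀ : 0 < a) (ha : a ≤ 7 / 10) (hb₀ : 0 < b)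
    (hb₁ : b < 1) (hr : r * (1 + a ^ 3) ≤ a ^ 2) :
    0 < (1 - a * b ^ 8) ^ 2 - a ^ 2 *
      (b ^ 4 * (1 - b ^ 3) ^ 2 * (b ^ 6 + 2 * b ^ 3 + 3)) -
      3 * r * b * (1 - a ^ 3 * b ^ 3) * (1 - b ^ 3) := by
  obtain ⟨q, hq⟩ : ∃ q, q = b ^ 4 * (1 - b ^ 3) ^ 2 * (b ^ 6 + 2 * b ^ 3 + 3) := ⟨_, rfl⟩
  have hd : 0 < 1 - b := sub_pos.2 hb₁
  have hw : 0 < 1 - b ^ 3 := sub_pos.2 (pow_lt_one₀ hb₀.le hb₁ three_ne_zero)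
  have h₁ : 0 < 2 * 1 + 7 / 10 * (-2 * b ^ 8 - 159 / 100 * b * (1 - b ^ 3)) := by
    have hpos : 0 < (
      2000 * (1 - b) ^ 8 + 14887 * b * (1 - b) ^ 7 + 48209 * b ^ 2 * (1 - b) ^ 6 +
        88627 * b ^ 3 * (1 - b) ^ 5 + 102158 * b ^ 4 * (1 - b) ^ 4 + 77497 * b ^ 5 * (1 - b) ^ 3 +
        39305 * b ^ 6 * (1 - b) ^ 2 + 12661 * b ^ 7 * (1 - b) + 600 * b ^ 8) / 1000 := by positivity
    linear_combination hpos
  have h₂ : 0 < 1 + 7 / 10 * (-2 * b ^ 8 - 159 / 100 * b * (1 - b ^ 3)) +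
      (7 / 10) ^ 2 * (b ^ 16 - q) := by
    have hpos : 0 < (
      1000 * (1 - b) ^ 16 + 14887 * b * (1 - b) ^ 15 + 103305 * b ^ 2 * (1 - b) ^ 14 +
        443135 * b ^ 3 * (1 - b) ^ 13 + 1313228 * b ^ 4 * (1 - b) ^ 12 +
        2844471 * b ^ 5 * (1 - b) ^ 11 + 4642099 * b ^ 6 * (1 - b) ^ 10 +
        5792855 * b ^ 7 * (1 - b) ^ 9 + 5547370 * b ^ 8 * (1 - b) ^ 8 +
        4054461 * b ^ 9 * (1 - b) ^ 7 + 2233007 * b ^ 10 * (1 - b) ^ 6 +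
        911477 * b ^ 11 * (1 - b) ^ 5 + 273000 * b ^ 12 * (1 - b) ^ 4 +
        61285 * b ^ 13 * (1 - b) ^ 3 + 10933 * b ^ 14 * (1 - b) ^ 2 + 1461 * b ^ 15 * (1 - b) +
        90 * b ^ 16) / 1000 := by positivity
    rw [hq]
    linear_combination hpos
  have hquad := quadratic_pos_of_bernstein (by norm_num) ha₀.le ha one_pos h₁ h₂
  have ha_le : a ≤ 53 / 100 * (1 + a ^ 3) := by
    nlinarith [mul_nonneg ha₀.le (sq_nonneg (a - 4 / 5)), sq_nonneg (a - 4 / 5)]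
  have hra : r ≤ 53 / 100 * a := by
    refine le_of_mul_le_mul_right (hr.trans ?_) (by positivity : 0 < 1 + a ^ 3)
    nlinarith
  have hy : 0 ≤ 1 - a ^ 3 * b ^ 3 :=
    sub_nonneg.2 (mul_le_one₀ (pow_le_one₀ ha₀.le (by linarith)) (by positivity)
      (pow_le_one₀ hb₀.le hb₁.le))
  have hrem : 3 * r * b * (1 - a ^ 3 * b ^ 3) * (1 - b ^ 3) ≤
      159 / 100 * a * b * (1 - b ^ 3) := by
    calc 3 * r * b * (1 - a ^ 3 * b ^ 3) * (1 - b ^ 3)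
        ≤ 3 * (53 / 100 * a) * b * (1 - a ^ 3 * b ^ 3) * (1 - b ^ 3) := by gcongr
      _ ≤ 3 * (53 / 100 * a) * b * 1 * (1 - b ^ 3) := by
          gcongr
          exact sub_le_self _ (by positivity)
      _ = 159 / 100 * a * b * (1 - b ^ 3) := by ring
  rw [← hq]
  linear_combination hquad + hrem

theorem potential_pos_of_ge {a b r : ℝ} (ha : 7 / 10 ≤ a) (ha₁ : a ≤ 1) (hb₀ : 0 < b)
    (hb₁ : b < 1) (hr : r * a ≤ 1 / 3) :
    0 < (1 - a * b ^ 8) ^ 2 - a ^ 2 *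
      (b ^ 4 * (1 - b ^ 3) ^ 2 * (b ^ 6 + 2 * b ^ 3 + 3)) -
      3 * r * b * (1 - a ^ 3 * b ^ 3) * (1 - b ^ 3) := by
  obtain ⟨q, hq⟩ : ∃ q, q = b ^ 4 * (1 - b ^ 3) ^ 2 * (b ^ 6 + 2 * b ^ 3 + 3) := ⟨_, rfl⟩
  have hd : 0 < 1 - b := sub_pos.2 hb₁
  have hw : 0 < 1 - b ^ 3 := sub_pos.2 (pow_lt_one₀ hb₀.le hb₁ three_ne_zero)
  have ha₀ : 0 < a := by linarith
  have h₀ : 0 < (1 - b ^ 8) ^ 2 - q - b * (1 - b ^ 3) ^ 2 := by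
    have hpos : 0 < (1 - b) ^ 2 * (
      (1 - b) ^ 14 + 15 * b * (1 - b) ^ 13 + 105 * b ^ 2 * (1 - b) ^ 12 +
        455 * b ^ 3 * (1 - b) ^ 11 + 1364 * b ^ 4 * (1 - b) ^ 10 + 2991 * b ^ 5 * (1 - b) ^ 9 +
        4939 * b ^ 6 * (1 - b) ^ 8 + 6218 * b ^ 7 * (1 - b) ^ 7 + 5965 * b ^ 8 * (1 - b) ^ 6 +
        4305 * b ^ 9 * (1 - b) ^ 5 + 2275 * b ^ 10 * (1 - b) ^ 4 + 839 * b ^ 11 * (1 - b) ^ 3 +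
        198 * b ^ 12 * (1 - b) ^ 2 + 25 * b ^ 13 * (1 - b) + b ^ 14) := by positivity
    rw [hq]
    linear_combination hpos
  have h₁ : 0 < 2 * ((1 - b ^ 8) ^ 2 - q - b * (1 - b ^ 3) ^ 2) +
      3 / 10 * (2 * b ^ 8 * (1 - b ^ 8) + 2 * q - b * (1 - b ^ 3) * (1 + 2 * b ^ 3)) := by
    have hpos : 0 < (1 - b) * (
      20 * (1 - b) ^ 15 + 297 * b * (1 - b) ^ 14 + 2055 * b ^ 2 * (1 - b) ^ 13 +
        8785 * b ^ 3 * (1 - b) ^ 12 + 25930 * b ^ 4 * (1 - b) ^ 11 +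
        55905 * b ^ 5 * (1 - b) ^ 10 + 90761 * b ^ 6 * (1 - b) ^ 9 +
        112627 * b ^ 7 * (1 - b) ^ 8 + 107264 * b ^ 8 * (1 - b) ^ 7 +
        78075 * b ^ 9 * (1 - b) ^ 6 + 43001 * b ^ 10 * (1 - b) ^ 5 +
        17719 * b ^ 11 * (1 - b) ^ 4 + 5442 * b ^ 12 * (1 - b) ^ 3 + 1259 * b ^ 13 * (1 - b) ^ 2 +
        215 * b ^ 14 * (1 - b) + 21 * b ^ 15) / 10 := by positivity
    rw [hq]
    linear_combination hpos
  have h₂ : 0 < ((1 - b ^ 8) ^ 2 - q - b * (1 - b ^ 3) ^ 2) +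
      3 / 10 * (2 * b ^ 8 * (1 - b ^ 8) + 2 * q - b * (1 - b ^ 3) * (1 + 2 * b ^ 3)) +
      (3 / 10) ^ 2 * (b ^ 16 - q - b * (1 - b ^ 3) * (10 / 7 - b ^ 3)) := by
    have hpos : 0 < (
      700 * (1 - b) ^ 16 + 10200 * b * (1 - b) ^ 15 + 69000 * b ^ 2 * (1 - b) ^ 14 +
        287000 * b ^ 3 * (1 - b) ^ 13 + 819314 * b ^ 4 * (1 - b) ^ 12 +
        1696368 * b ^ 5 * (1 - b) ^ 11 + 2623324 * b ^ 6 * (1 - b) ^ 10 +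
        3073109 * b ^ 7 * (1 - b) ^ 9 + 2737711 * b ^ 8 * (1 - b) ^ 8 +
        1850892 * b ^ 9 * (1 - b) ^ 7 + 949732 * b ^ 10 * (1 - b) ^ 6 +
        378062 * b ^ 11 * (1 - b) ^ 5 + 125484 * b ^ 12 * (1 - b) ^ 4 +
        37636 * b ^ 13 * (1 - b) ^ 3 + 9328 * b ^ 14 * (1 - b) ^ 2 + 1389 * b ^ 15 * (1 - b) +
        63 * b ^ 16) / 700 := by positivity
    rw [hq]
    linear_combination hpos
  have hquad := quadratic_pos_of_bernstein (t := 1 - a) (by norm_num) (by linarith) (by linarith)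
    h₀ h₁ h₂
  have hy : 0 ≤ 1 - a ^ 3 * b ^ 3 :=
    sub_nonneg.2 (mul_le_one₀ (pow_le_one₀ ha₀.le ha₁) (by positivity)
      (pow_le_one₀ hb₀.le hb₁.le))
  have hinv : a⁻¹ ≤ 1 + (1 - a) + 10 / 7 * (1 - a) ^ 2 := by
    rw [inv_le_iff_one_le_mul₀' ha₀]
    nlinarith [mul_nonneg (sq_nonneg (1 - a)) (sub_nonneg.2 ha)]
  have hrem : 3 * r * b * (1 - a ^ 3 * b ^ 3) * (1 - b ^ 3) ≤
      ((1 + (1 - a) + 10 / 7 * (1 - a) ^ 2) - a ^ 2 * b ^ 3) * (b * (1 - b ^ 3)) := by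
    calc 3 * r * b * (1 - a ^ 3 * b ^ 3) * (1 - b ^ 3)
        = 3 * (r * a) * b * (1 - a ^ 3 * b ^ 3) * (1 - b ^ 3) * a⁻¹ := by field_simp
      _ ≤ 3 * (1 / 3) * b * (1 - a ^ 3 * b ^ 3) * (1 - b ^ 3) * a⁻¹ := by gcongr
      _ = (a⁻¹ - a ^ 2 * b ^ 3) * (b * (1 - b ^ 3)) := by field_simp
      _ ≤ _ := by gcongr
  rw [← hq]
  linear_combination hquad + hrem

/-- Positivity of the potential in the variables `1 - z = (a * b) ^ 3`, `1 - z ^ (l - 1) = b ^ 3`,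
with `1 / l` relaxed to any `s` satisfying the bounds. -/
theorem potential_pos {a b s : ℝ} (ha₀ : 0 < a) (ha₁ : a ≤ 1) (hb₀ : 0 < b) (hb₁ : b < 1)
    (hs : s ≤ 1 / 3) (hsa : s * (1 + a ^ 3) ≤ a ^ 3) :
    0 < -(3 * s * (1 - a ^ 3 * b ^ 3) * (1 - b ^ 3)) + a ^ 3 * b ^ 3 * (4 * b ^ 3 - 3) + a / b -
      2 * a ^ 2 * b ^ 7 := by
  have key : 0 < (1 - a * b ^ 8) ^ 2 - a ^ 2 *
      (b ^ 4 * (1 - b ^ 3) ^ 2 * (b ^ 6 + 2 * b ^ 3 + 3)) -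
      3 * (s / a) * b * (1 - a ^ 3 * b ^ 3) * (1 - b ^ 3) := by
    rcases le_total a (7 / 10) with ha | ha
    · refine potential_pos_of_le ha₀ ha hb₀ hb₁ ?_
      rw [div_mul_eq_mul_div, div_le_iff₀ ha₀]
      linarith
    · exact potential_pos_of_ge ha ha₁ hb₀ hb₁ (by rwa [div_mul_cancel₀ _ ha₀.ne'])
  refine (mul_pos (div_pos ha₀ hb₀) key).trans_eq ?_
  field_simp
  ring

theorem rpow_div_three_of_pow {c : ℝ} (hc : 0 ≤ c) (n : ℤ) :
    (c ^ 3) ^ ((n : ℝ) / 3) = c ^ n := by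
  rw [← Real.rpow_natCast, ← Real.rpow_mul hc, ← Real.rpow_intCast]
  congr 1
  push_cast
  ring

/-- For every `l ≥ 3` and `z ∈ (0,1)`, `U(z) > 0`. -/
theorem stmt1 (l : ℕ) (hl : 3 ≤ l) (z : ℝ) (hz : z ∈ Set.Ioo (0:ℝ) 1) :
    0 < Uz l z := by
  obtain ⟨hz₀, hz₁⟩ := hz
  have hx₁ : z ^ (l - 1) < 1 := pow_lt_one₀ hz₀.le hz₁ (by omega)
  have hxz : z ^ (l - 1) ≤ z := pow_le_of_le_one hz₀.le hz₁.le (by omega)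
  have hw₀ : 0 < 1 - z ^ (l - 1) := sub_pos.2 hx₁
  obtain ⟨b, hb₀, hb⟩ : ∃ b : ℝ, 0 < b ∧ b ^ 3 = 1 - z ^ (l - 1) :=
    ⟨(1 - z ^ (l - 1)) ^ ((3 : ℕ) : ℝ)⁻¹, by positivity,
      Real.rpow_inv_natCast_pow hw₀.le three_ne_zero⟩
  have hy₀ : 0 < 1 - z := sub_pos.2 hz₁
  obtain ⟨c, hc₀, hc⟩ : ∃ c : ℝ, 0 < c ∧ c ^ 3 = 1 - z :=
    ⟨(1 - z) ^ ((3 : ℕ) : ℝ)⁻¹, by positivity, Real.rpow_inv_natCast_pow hy₀.le three_ne_zero⟩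
  have hl₀ : (3 : ℝ) ≤ l := by exact_mod_cast hl
  have hb₁ : b < 1 := by
    refine lt_of_pow_lt_pow_left₀ 3 zero_le_one ?_
    rw [hb, one_pow]
    exact sub_lt_self _ (by positivity)
  have hcb : c ≤ b := le_of_pow_le_pow_left₀ three_ne_zero hb₀.le (by linarith)
  have hbern : b ^ 3 ≤ (l - 1) * c ^ 3 := by
    have h := one_add_mul_le_pow (a := z - 1) (by linarith) (l - 1)
    rw [Nat.cast_sub (by omega), Nat.cast_one, add_sub_cancel] at h
    rw [hb, hc]
    linarith
  have hpos := potential_pos (a := c / b) (s := 1 / l) (by positivity) ((div_le_one hb₀).2 hcb)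
    hb₀ hb₁ (one_div_le_one_div_of_le (by norm_num) hl₀) (by
      rw [div_pow, one_div, inv_mul_le_iff₀ (by linarith)]
      have : 1 ≤ (l - 1) * (c ^ 3 / b ^ 3) := by
        rwa [← mul_div_assoc, one_le_div (by positivity)]
      linarith)
  have hzl : z ^ l = (1 - c ^ 3) * (1 - b ^ 3) := by
    rw [hb, hc, sub_sub_cancel, sub_sub_cancel, mul_pow_sub_one (by omega)]
  have hx : z ^ (l - 1) = 1 - b ^ 3 := by rw [hb, sub_sub_cancel]
  have e₁ := rpow_div_three_of_pow hc₀.le 1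
  have e₂ := rpow_div_three_of_pow hc₀.le 2
  have e₃ := rpow_div_three_of_pow hb₀.le (-2)
  have e₄ := rpow_div_three_of_pow hb₀.le 5
  push_cast at e₁ e₂ e₃ e₄
  rw [Uz, hzl, ← hb, ← hc, hx, e₁, e₂, e₃, e₄]
  refine hpos.trans_eq ?_
  rw [zpow_one, zpow_neg]
  norm_cast
  field_simp
  ring
end

section
/- For every integer l with 3 ≤ l ≤ 164 and every z ∈ (0,1), I(z) < 0. -/
open Real

/-- `H(u,z)` for the `(l,3,3)` MN codes. -/
noncomputable def Hfun (l : ℕ) (u z : ℝ) : ℝ :=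
  (u + 3 * z^l / (l:ℝ) - (1-z) * (1 - 4 * z^(l-1)))^3
    + 6 * (1-z) * (1 - z^(l-1)) * (u + 3 * z^l / (l:ℝ) - (1-z) * (1 - 4 * z^(l-1)))
    - (1-z) * (1 - z^(l-1)) ^ (-2 : ℤ)
    + 8 * (1-z)^2 * (1 - z^(l-1))^5

/-- `I(z) := l³(1-z^{l-1})²/((1-z)z²) · H(0,z)`. -/
noncomputable def Ifun (l : ℕ) (z : ℝ) : ℝ :=
  (l:ℝ)^3 * (1 - z^(l-1))^2 / ((1-z) * z^2) * Hfun l 0 z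

/-- Bernstein-form positivity of the zeroth coefficient of `marginPoly` along `a = b + c`. -/
lemma marginPoly_zeroth_coeff_pos {b : ℝ} (hb0 : 0 < b) (hb1 : b < 1) :
    0 < 8 + 32 * b - 10 * b ^ 2 - 186 * b ^ 3 - 67 * b ^ 4 + 624 * b ^ 5 + 499 * b ^ 6
      - 1109 * b ^ 7 - 1200 * b ^ 8 + 1259 * b ^ 9 + 1829 * b ^ 10 - 594 * b ^ 11
      - 1541 * b ^ 12 - 140 * b ^ 13 + 624 * b ^ 14 + 224 * b ^ 15 - 80 * b ^ 16
      - 56 * b ^ 17 - 8 * b ^ 18 := by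
  have hd : 0 < 1 - b := sub_pos.2 hb1
  calc
    (0 : ℝ) < 8 * (1 - b) ^ 18 + 176 * b * (1 - b) ^ 17 + 1758 * b ^ 2 * (1 - b) ^ 16
        + 10534 * b ^ 3 * (1 - b) ^ 15 + 42183 * b ^ 4 * (1 - b) ^ 14
        + 119260 * b ^ 5 * (1 - b) ^ 13 + 246212 * b ^ 6 * (1 - b) ^ 12
        + 382217 * b ^ 7 * (1 - b) ^ 11 + 464694 * b ^ 8 * (1 - b) ^ 10
        + 471620 * b ^ 9 * (1 - b) ^ 9 + 427441 * b ^ 10 * (1 - b) ^ 8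
        + 351058 * b ^ 11 * (1 - b) ^ 7 + 251104 * b ^ 12 * (1 - b) ^ 6
        + 152924 * b ^ 13 * (1 - b) ^ 5 + 79361 * b ^ 14 * (1 - b) ^ 4
        + 32819 * b ^ 15 * (1 - b) ^ 3 + 9243 * b ^ 16 * (1 - b) ^ 2 + 1512 * b ^ 17 * (1 - b)
        + 108 * b ^ 18 := by positivity
    _ = _ := by ring

/-- Bernstein-form positivity of the first coefficient of `marginPoly` along `a = b + c`. -/
lemma marginPoly_first_coeff_pos {b : ℝ} (hb0 : 0 < b) (hb1 : b < 1) :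
    0 < 16 + 56 * b + 48 * b ^ 2 - 188 * b ^ 3 - 530 * b ^ 4 + 296 * b ^ 5 + 2182 * b ^ 6
      + 563 * b ^ 7 - 4076 * b ^ 8 - 2041 * b ^ 9 + 4612 * b ^ 10 + 2978 * b ^ 11
      - 3008 * b ^ 12 - 2380 * b ^ 13 + 928 * b ^ 14 + 992 * b ^ 15 - 32 * b ^ 16
      - 168 * b ^ 17 - 32 * b ^ 18 := by
  have hd : 0 < 1 - b := sub_pos.2 hb1
  calc
    (0 : ℝ) < 16 * (1 - b) ^ 18 + 344 * b * (1 - b) ^ 17 + 3448 * b ^ 2 * (1 - b) ^ 16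
        + 21252 * b ^ 3 * (1 - b) ^ 15 + 89450 * b ^ 4 * (1 - b) ^ 14
        + 270384 * b ^ 5 * (1 - b) ^ 13 + 603172 * b ^ 6 * (1 - b) ^ 12
        + 1012199 * b ^ 7 * (1 - b) ^ 11 + 1309291 * b ^ 8 * (1 - b) ^ 10
        + 1366244 * b ^ 9 * (1 - b) ^ 9 + 1234638 * b ^ 10 * (1 - b) ^ 8
        + 1017800 * b ^ 11 * (1 - b) ^ 7 + 745714 * b ^ 12 * (1 - b) ^ 6
        + 452922 * b ^ 13 * (1 - b) ^ 5 + 217822 * b ^ 14 * (1 - b) ^ 4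
        + 79829 * b ^ 15 * (1 - b) ^ 3 + 20289 * b ^ 16 * (1 - b) ^ 2 + 3114 * b ^ 17 * (1 - b)
        + 216 * b ^ 18 := by positivity
    _ = _ := by ring

/-- Bernstein-form positivity of the second coefficient of `marginPoly` along `a = b + c`. -/
lemma marginPoly_second_coeff_pos {b : ℝ} (hb0 : 0 < b) (hb1 : b < 1) :
    0 < 8 + 36 * b + 48 * b ^ 2 + b ^ 3 - 273 * b ^ 4 - 492 * b ^ 5 + 939 * b ^ 6
      + 2508 * b ^ 7 - 1134 * b ^ 8 - 4950 * b ^ 9 + 546 * b ^ 10 + 5358 * b ^ 11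
      + 192 * b ^ 12 - 3360 * b ^ 13 - 432 * b ^ 14 + 1152 * b ^ 15 + 240 * b ^ 16
      - 168 * b ^ 17 - 48 * b ^ 18 := by
  have hd : 0 < 1 - b := sub_pos.2 hb1
  calc
    (0 : ℝ) < 8 * (1 - b) ^ 18 + 180 * b * (1 - b) ^ 17 + 1884 * b ^ 2 * (1 - b) ^ 16
        + 12193 * b ^ 3 * (1 - b) ^ 15 + 54462 * b ^ 4 * (1 - b) ^ 14
        + 176895 * b ^ 5 * (1 - b) ^ 13 + 428795 * b ^ 6 * (1 - b) ^ 12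
        + 787185 * b ^ 7 * (1 - b) ^ 11 + 1112022 * b ^ 8 * (1 - b) ^ 10
        + 1248149 * b ^ 9 * (1 - b) ^ 9 + 1179987 * b ^ 10 * (1 - b) ^ 8
        + 995841 * b ^ 11 * (1 - b) ^ 7 + 744724 * b ^ 12 * (1 - b) ^ 6
        + 458031 * b ^ 13 * (1 - b) ^ 5 + 215835 * b ^ 14 * (1 - b) ^ 4
        + 74549 * b ^ 15 * (1 - b) ^ 3 + 17640 * b ^ 16 * (1 - b) ^ 2 + 2553 * b ^ 17 * (1 - b)
        + 171 * b ^ 18 := by positivity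
    _ = _ := by ring

/-- Bernstein-form positivity of the third coefficient of `marginPoly` along `a = b + c`. -/
lemma marginPoly_third_coeff_pos {b : ℝ} (hb0 : 0 < b) (hb1 : b < 1) :
    0 < 12 + 24 * b + 7 * b ^ 2 - 8 * b ^ 3 - 164 * b ^ 4 - 152 * b ^ 5 + 836 * b ^ 6
      + 904 * b ^ 7 - 1650 * b ^ 8 - 1760 * b ^ 9 + 1786 * b ^ 10 + 1696 * b ^ 11
      - 1120 * b ^ 12 - 896 * b ^ 13 + 384 * b ^ 14 + 256 * b ^ 15 - 56 * b ^ 16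
      - 32 * b ^ 17 := by
  have hd : 0 < 1 - b := sub_pos.2 hb1
  calc
    (0 : ℝ) < 12 * (1 - b) ^ 17 + 228 * b * (1 - b) ^ 16 + 2023 * b ^ 2 * (1 - b) ^ 15
        + 11137 * b ^ 3 * (1 - b) ^ 14 + 42459 * b ^ 4 * (1 - b) ^ 13
        + 118109 * b ^ 5 * (1 - b) ^ 12 + 246207 * b ^ 6 * (1 - b) ^ 11
        + 391745 * b ^ 7 * (1 - b) ^ 10 + 487969 * b ^ 8 * (1 - b) ^ 9
        + 497323 * b ^ 9 * (1 - b) ^ 8 + 436383 * b ^ 10 * (1 - b) ^ 7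
        + 332233 * b ^ 11 * (1 - b) ^ 6 + 206783 * b ^ 12 * (1 - b) ^ 5
        + 97361 * b ^ 13 * (1 - b) ^ 4 + 32819 * b ^ 14 * (1 - b) ^ 3
        + 7453 * b ^ 15 * (1 - b) ^ 2 + 1033 * b ^ 16 * (1 - b) + 67 * b ^ 17 := by positivity
    _ = _ := by ring

/-- Bernstein-form positivity of the fourth coefficient of `marginPoly` along `a = b + c`. -/
lemma marginPoly_fourth_coeff_pos {b : ℝ} (hb0 : 0 < b) (hb1 : b < 1) :
    0 < 6 + 5 * b - 2 * b ^ 2 - 38 * b ^ 4 + 226 * b ^ 6 - 440 * b ^ 8 + 424 * b ^ 10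
      - 224 * b ^ 12 + 64 * b ^ 14 - 8 * b ^ 16 := by
  have hd : 0 < 1 - b := sub_pos.2 hb1
  calc
    (0 : ℝ) < 6 * (1 - b) ^ 16 + 101 * b * (1 - b) ^ 15 + 793 * b ^ 2 * (1 - b) ^ 14
        + 3857 * b ^ 3 * (1 - b) ^ 13 + 12975 * b ^ 4 * (1 - b) ^ 12
        + 31849 * b ^ 5 * (1 - b) ^ 11 + 58779 * b ^ 6 * (1 - b) ^ 10
        + 83561 * b ^ 7 * (1 - b) ^ 9 + 94309 * b ^ 8 * (1 - b) ^ 8 + 87455 * b ^ 9 * (1 - b) ^ 7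
        + 67519 * b ^ 10 * (1 - b) ^ 6 + 41979 * b ^ 11 * (1 - b) ^ 5
        + 19729 * b ^ 12 * (1 - b) ^ 4 + 6611 * b ^ 13 * (1 - b) ^ 3 + 1485 * b ^ 14 * (1 - b) ^ 2
        + 203 * b ^ 15 * (1 - b) + 13 * b ^ 16 := by positivity
    _ = _ := by ring

/-- With `v = 1 - w` and `s = 1 - z = v / (1 + a)`, this is the negated numerator of the upper
bound for `H(0,z)` obtained from `1 / l ≤ s / (v + s)`. -/
def marginPoly (a v : ℝ) : ℝ :=
  (2 + a) ^ 3 * (1 + a) ^ 2 - v * (3 * (1 + a) - v ^ 2 * (5 + 4 * a)) ^ 3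
    - 6 * v ^ 3 * (3 * (1 + a) - v ^ 2 * (5 + 4 * a)) * (2 + a) ^ 2 * (1 + a)
    - 8 * v ^ 8 * (1 + a) * (2 + a) ^ 3

lemma marginPoly_pos {b c : ℝ} (hb0 : 0 < b) (hb1 : b < 1) (hc : 0 ≤ c) :
    0 < marginPoly (b + c) (1 - b ^ 2) := by
  have h0 := marginPoly_zeroth_coeff_pos hb0 hb1
  have h1 := marginPoly_first_coeff_pos hb0 hb1
  have h2 := marginPoly_second_coeff_pos hb0 hb1
  have h3 := marginPoly_third_coeff_pos hb0 hb1
  have h4 := marginPoly_fourth_coeff_pos hb0 hb1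
  calc
    0 < b ^ 2 * (8 + 32 * b - 10 * b ^ 2 - 186 * b ^ 3 - 67 * b ^ 4 + 624 * b ^ 5
        + 499 * b ^ 6 - 1109 * b ^ 7 - 1200 * b ^ 8 + 1259 * b ^ 9 + 1829 * b ^ 10
        - 594 * b ^ 11 - 1541 * b ^ 12 - 140 * b ^ 13 + 624 * b ^ 14 + 224 * b ^ 15
        - 80 * b ^ 16 - 56 * b ^ 17 - 8 * b ^ 18) + c * b * (16 + 56 * b + 48 * b ^ 2
        - 188 * b ^ 3 - 530 * b ^ 4 + 296 * b ^ 5 + 2182 * b ^ 6 + 563 * b ^ 7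
        - 4076 * b ^ 8 - 2041 * b ^ 9 + 4612 * b ^ 10 + 2978 * b ^ 11 - 3008 * b ^ 12
        - 2380 * b ^ 13 + 928 * b ^ 14 + 992 * b ^ 15 - 32 * b ^ 16 - 168 * b ^ 17
        - 32 * b ^ 18) + c ^ 2 * (8 + 36 * b + 48 * b ^ 2 + b ^ 3 - 273 * b ^ 4
        - 492 * b ^ 5 + 939 * b ^ 6 + 2508 * b ^ 7 - 1134 * b ^ 8 - 4950 * b ^ 9
        + 546 * b ^ 10 + 5358 * b ^ 11 + 192 * b ^ 12 - 3360 * b ^ 13 - 432 * b ^ 14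
        + 1152 * b ^ 15 + 240 * b ^ 16 - 168 * b ^ 17 - 48 * b ^ 18) + c ^ 3 * (12 + 24 * b
        + 7 * b ^ 2 - 8 * b ^ 3 - 164 * b ^ 4 - 152 * b ^ 5 + 836 * b ^ 6 + 904 * b ^ 7
        - 1650 * b ^ 8 - 1760 * b ^ 9 + 1786 * b ^ 10 + 1696 * b ^ 11 - 1120 * b ^ 12
        - 896 * b ^ 13 + 384 * b ^ 14 + 256 * b ^ 15 - 56 * b ^ 16 - 32 * b ^ 17)
        + c ^ 4 * (6 + 5 * b - 2 * b ^ 2 - 38 * b ^ 4 + 226 * b ^ 6 - 440 * b ^ 8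
        + 424 * b ^ 10 - 224 * b ^ 12 + 64 * b ^ 14 - 8 * b ^ 16) + c ^ 5 := by
        refine add_pos_of_pos_of_nonneg (add_pos_of_pos_of_nonneg (add_pos_of_pos_of_nonneg
          (add_pos_of_pos_of_nonneg (add_pos_of_pos_of_nonneg ?_ ?_) ?_) ?_) ?_) (pow_nonneg hc 5)
        · exact mul_pos (pow_pos hb0 2) h0
        · exact mul_nonneg (mul_nonneg hc hb0.le) h1.le
        · exact mul_nonneg (pow_nonneg hc 2) h2.le
        · exact mul_nonneg (pow_nonneg hc 3) h3.le
        · exact mul_nonneg (pow_nonneg hc 4) h4.le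
    _ = _ := by unfold marginPoly; ring

/-- The bracket in `H`, divided by `1 - z`, after the estimate `1 / l ≤ s / (v + s)`. -/
lemma bracket_bound_neg {a v : ℝ} (ha : 0 < a) (hv : 0 < v) (hM : 0 < marginPoly a v) :
    (v / (1 + a)) ^ 2 * (3 * (1 - v / (1 + a)) * (1 - v) / (v + v / (1 + a)) - 1 + 4 * (1 - v)) ^ 3
      + 6 * (v / (1 + a)) * v
        * (3 * (1 - v / (1 + a)) * (1 - v) / (v + v / (1 + a)) - 1 + 4 * (1 - v))
      + 8 * (v / (1 + a)) * v ^ 5 - 1 / v ^ 2 < 0 := by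
  have hB : 3 * (1 - v / (1 + a)) * (1 - v) / (v + v / (1 + a)) - 1 + 4 * (1 - v)
      = (3 * (1 + a) - v ^ 2 * (5 + 4 * a)) / (v * (2 + a)) := by
    have : v + v / (1 + a) = v * (2 + a) / (1 + a) := by field_simp; ring
    rw [this]
    field_simp
    ring
  rw [hB]
  have key : (v / (1 + a)) ^ 2 * ((3 * (1 + a) - v ^ 2 * (5 + 4 * a)) / (v * (2 + a))) ^ 3
      + 6 * (v / (1 + a)) * v * ((3 * (1 + a) - v ^ 2 * (5 + 4 * a)) / (v * (2 + a)))
      + 8 * (v / (1 + a)) * v ^ 5 - 1 / v ^ 2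
      = -(marginPoly a v / (v ^ 2 * (2 + a) ^ 3 * (1 + a) ^ 2)) := by
    unfold marginPoly
    field_simp
    ring
  rw [key, neg_lt_zero]
  positivity

lemma Hfun_zero_neg {l : ℕ} (hl : 3 ≤ l) {z : ℝ} (hz0 : 0 < z) (hz1 : z < 1) :
    Hfun l 0 z < 0 := by
  obtain ⟨n, rfl⟩ : ∃ n, l = n + 1 := ⟨l - 1, by omega⟩
  have hn : 2 ≤ n := by omega
  have hs : 0 < 1 - z := sub_pos.2 hz1
  set b := √(z ^ n) with hb
  have hbw : b ^ 2 = z ^ n := Real.sq_sqrt (by positivity)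
  have hb0 : 0 < b := Real.sqrt_pos.2 (by positivity)
  have hbz : b ≤ z := by
    rw [hb, Real.sqrt_le_left hz0.le]
    exact pow_le_pow_of_le_one hz0.le hz1.le hn
  have hb1 : b < 1 := hbz.trans_lt hz1
  have hv : 0 < 1 - b ^ 2 := by nlinarith
  obtain ⟨c, hc⟩ : ∃ c, (1 - b ^ 2) / (1 - z) - 1 = b + c := ⟨_, (add_sub_cancel b _).symm⟩
  have hc0 : 0 ≤ c := by
    have : 1 + b ≤ (1 - b ^ 2) / (1 - z) := by
      rw [le_div_iff₀ hs]
      nlinarith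
    linarith
  have hsa : (1 - b ^ 2) / (1 + (b + c)) = 1 - z := by
    rw [← hc, add_sub_cancel, div_div_cancel₀ hv.ne']
  have hneg := bracket_bound_neg (by positivity : 0 < b + c) hv (marginPoly_pos hb0 hb1 hc0)
  rw [hsa, sub_sub_cancel, sub_sub_cancel] at hneg
  have hbern : 1 - b ^ 2 ≤ n * (1 - z) := by
    have h := one_add_mul_le_pow (by linarith : (-2 : ℝ) ≤ -(1 - z)) n
    rw [show 1 + -(1 - z) = z by ring, ← hbw] at h
    linarith
  set B := 3 * z * b ^ 2 / (1 - b ^ 2 + (1 - z)) - 1 + 4 * b ^ 2 with hB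
  have hA : 0 + 3 * z ^ (n + 1) / ((n + 1 : ℕ) : ℝ) - (1 - z) * (1 - 4 * z ^ n) ≤ (1 - z) * B := by
    have h : 3 * z * b ^ 2 / ((n + 1 : ℕ) : ℝ)
        ≤ (1 - z) * (3 * z * b ^ 2 / (1 - b ^ 2 + (1 - z))) := by
      rw [← mul_div_assoc, div_le_div_iff₀ (by positivity) (by positivity)]
      have : 1 - b ^ 2 + (1 - z) ≤ (1 - z) * ((n + 1 : ℕ) : ℝ) := by push_cast; linarith
      calc 3 * z * b ^ 2 * (1 - b ^ 2 + (1 - z))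
          ≤ 3 * z * b ^ 2 * ((1 - z) * ((n + 1 : ℕ) : ℝ)) := by gcongr
        _ = _ := by ring
    rw [pow_succ, ← hbw, show 3 * (b ^ 2 * z) = 3 * z * b ^ 2 by ring, hB]
    linarith
  unfold Hfun
  rw [Nat.add_sub_cancel]
  generalize 0 + 3 * z ^ (n + 1) / ((n + 1 : ℕ) : ℝ) - (1 - z) * (1 - 4 * z ^ n) = A at hA ⊢
  rw [← hbw, zpow_neg, zpow_ofNat]
  calc A ^ 3 + 6 * (1 - z) * (1 - b ^ 2) * A - (1 - z) * ((1 - b ^ 2) ^ 2)⁻¹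
        + 8 * (1 - z) ^ 2 * (1 - b ^ 2) ^ 5
      ≤ ((1 - z) * B) ^ 3 + 6 * (1 - z) * (1 - b ^ 2) * ((1 - z) * B)
        - (1 - z) * ((1 - b ^ 2) ^ 2)⁻¹ + 8 * (1 - z) ^ 2 * (1 - b ^ 2) ^ 5 := by
        have h3 : A ^ 3 ≤ ((1 - z) * B) ^ 3 := Odd.strictMono_pow (by decide) |>.monotone hA
        gcongr
    _ = (1 - z) * ((1 - z) ^ 2 * B ^ 3 + 6 * (1 - z) * (1 - b ^ 2) * B
        + 8 * (1 - z) * (1 - b ^ 2) ^ 5 - 1 / (1 - b ^ 2) ^ 2) := by ring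
    _ < 0 := mul_neg_of_pos_of_neg hs hneg

/-- `I(z) < 0` on `(0,1)` for `3 ≤ l ≤ 164`. -/
theorem stmt7 (l : ℕ) (hl : 3 ≤ l) (hl' : l ≤ 164) (z : ℝ)
    (hz : z ∈ Set.Ioo (0:ℝ) 1) : Ifun l z < 0 := by
  obtain ⟨hz0, hz1⟩ := hz
  have hs : 0 < 1 - z := sub_pos.2 hz1
  have hv : 0 < 1 - z ^ (l - 1) := sub_pos.2 (pow_lt_one₀ hz0.le hz1 (by omega))
  have hl0 : (0 : ℝ) < l := by exact_mod_cast (by omega : 0 < l)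
  exact mul_neg_of_pos_of_neg (by positivity) (Hfun_zero_neg hl hz0 hz1)
end

section
/- For every integer l ≥ 165 and every z ∈ (0,1), I(z) < -l³ + (6775346/41325)·l² + (444/5)·l. -/
open Real

lemma pow_mul_one_add_mul_le_one {z : ℝ} (h0 : 0 ≤ z) (n : ℕ) :
    z ^ n * (1 + n * (1 - z)) ≤ 1 := by
  induction n with
  | zero => simp
  | succ n ih =>
    have hp : 0 ≤ z ^ n := pow_nonneg h0 n
    have hn : (0:ℝ) ≤ n := n.cast_nonneg
    have key : z * (1 + (n + 1) * (1 - z)) ≤ 1 + n * (1 - z) := by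
      nlinarith [mul_nonneg hn (sq_nonneg (1 - z)), sq_nonneg (1 - z)]
    calc z ^ (n + 1) * (1 + ((n + 1 : ℕ) : ℝ) * (1 - z))
        = z ^ n * (z * (1 + (n + 1) * (1 - z))) := by push_cast; ring
      _ ≤ z ^ n * (1 + n * (1 - z)) := mul_le_mul_of_nonneg_left key hp
      _ ≤ 1 := ih

/-- The bracket `(1-y)² H(0,z) / (1-z)`, with `y` in place of `z^{l-1}` and `w = 1 - z`, `m = 3z/l + 4w`,
exceeds its value `-z²` at `y = 0` by at most `80 z² / l`. -/
lemma bracket_le {L z w y m : ℝ} (hL : 165 ≤ L) (hz0 : 0 < z) (hw0 : 0 < w) (hzw : z = 1 - w)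
    (hy0 : 0 ≤ y) (hyz : y ≤ z ^ 2) (hLwy : L * w * y ≤ 1.02 * z ^ 2) (hyw : 1 - y ≤ L * w)
    (hm : m = 3 * z / L + 4 * w) :
    (1 - y) ^ 2 * (m * y - w) ^ 3 / w + 6 * (1 - y) ^ 3 * (m * y - w) - 1 + 8 * w * (1 - y) ^ 7
      ≤ - z ^ 2 + 80 * z ^ 2 / L := by
  have hL0 : 0 < L := by linarith
  have hz1 : z < 1 := by linarith
  have hw1 : w < 1 := by linarith
  have hzz : z ^ 2 ≤ 1 := by nlinarith
  have hy1 : y ≤ 1 := by linarith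
  have hm0 : 0 ≤ m := by rw [hm]; positivity
  have hm4 : m ≤ 4 := by
    have : 3 * z / L ≤ 4 * z := by
      rw [div_le_iff₀ hL0]; nlinarith
    rw [hm]; linarith
  have hq0 : 0 ≤ 1 - y := by linarith
  have hq1 : 1 - y ≤ 1 := by linarith
  have hLm : L * m = 3 * z + 4 * (L * w) := by rw [hm]; field_simp
  have hLmy : L * (m * y) ≤ 7.08 * z ^ 2 := by
    have : L * (m * y) = 3 * (z * y) + 4 * (L * w * y) := by rw [← mul_assoc, hLm]; ring
    have : z * y ≤ y := by nlinarith
    linarith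
  have hmy0 : 0 ≤ m * y := by positivity
  have hwy0 : 0 ≤ w * y := by positivity
  have hwmy : L * (w * m * y) ≤ 4.08 * z ^ 2 := by
    have : L * (w * m * y) = m * (L * w * y) := by ring
    have h2 : m * (L * w * y) ≤ 4 * (L * w * y) :=
      mul_le_mul_of_nonneg_right hm4 (by positivity)
    linarith
  have hsq : (1 - y) ^ 2 ≤ 1 := by nlinarith
  have hcu : (1 - y) ^ 3 ≤ 1 := pow_le_one₀ hq0 hq1
  have hsqw : (1 - y) ^ 2 / w ≤ L := by
    rw [div_le_iff₀ hw0]; nlinarith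
  have hcube : L * ((1 - y) ^ 2 / w * (m * y) ^ 3) ≤ 2.2 * z ^ 2 := by
    have h1 : (1 - y) ^ 2 / w * (m * y) ^ 3 ≤ L * (m * y) ^ 3 :=
      mul_le_mul_of_nonneg_right hsqw (by positivity)
    have h2 : (L * (m * y)) ^ 3 ≤ (7.08 * z ^ 2) ^ 3 :=
      pow_le_pow_left₀ (by positivity) hLmy 3
    have h3 : (7.08 * z ^ 2) ^ 3 ≤ 7.08 ^ 3 * z ^ 2 := by
      have : (z ^ 2) ^ 3 ≤ z ^ 2 := by
        simpa using pow_le_pow_of_le_one (sq_nonneg z) hzz (show 1 ≤ 3 by norm_num)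
      nlinarith
    have h4 : L * (L * (L * (m * y) ^ 3)) ≤ 7.08 ^ 3 * z ^ 2 := by
      calc _ = (L * (m * y)) ^ 3 := by ring
        _ ≤ _ := h2.trans h3
    have h5 : 165 * (L * (L * (m * y) ^ 3)) ≤ L * (L * (L * (m * y) ^ 3)) :=
      mul_le_mul_of_nonneg_right hL (by positivity)
    have h6 := mul_le_mul_of_nonneg_left h1 hL0.le
    nlinarith [sq_nonneg z]
  have hA : (1 - y) ^ 2 * (m * y - w) ^ 3 / w
      ≤ - w ^ 2 + 2 * (w * y) + 3 * (w * m * y) + (1 - y) ^ 2 / w * (m * y) ^ 3 := by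
    have e : (1 - y) ^ 2 * (m * y - w) ^ 3 / w = - ((1 - y) ^ 2 * w ^ 2)
        + (1 - y) ^ 2 * (3 * (w * m * y)) - 3 * ((1 - y) ^ 2 * (m * y) ^ 2)
        + (1 - y) ^ 2 / w * (m * y) ^ 3 := by
      field_simp; ring
    have h1 : w ^ 2 - (1 - y) ^ 2 * w ^ 2 ≤ 2 * (w * y) := by
      have : w ^ 2 * y ≤ w * y := by nlinarith
      nlinarith [mul_nonneg (sq_nonneg w) (sq_nonneg y)]
    have h2 : (1 - y) ^ 2 * (3 * (w * m * y)) ≤ 1 * (3 * (w * m * y)) :=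
      mul_le_mul_of_nonneg_right hsq (by positivity)
    have h3 : 0 ≤ (1 - y) ^ 2 * (m * y) ^ 2 := by positivity
    rw [e]; linarith
  have hB : 6 * (1 - y) ^ 3 * (m * y - w) ≤ - (6 * w) + 18 * (w * y) + 6 * (m * y) := by
    have h1 : (1 - y) ^ 3 * (m * y) ≤ 1 * (m * y) := mul_le_mul_of_nonneg_right hcu hmy0
    have h2 : 1 - 3 * y ≤ (1 - y) ^ 3 := by nlinarith [mul_nonneg (sq_nonneg y) hq0, sq_nonneg y]
    have h3 := mul_le_mul_of_nonneg_right h2 hw0.le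
    linarith
  have hC : 8 * w * (1 - y) ^ 7 ≤ 8 * w := by
    have : (1 - y) ^ 7 ≤ 1 := pow_le_one₀ hq0 hq1
    nlinarith
  have hsum : 20 * (w * y) + 3 * (w * m * y) + 6 * (m * y) + (1 - y) ^ 2 / w * (m * y) ^ 3
      ≤ 80 * z ^ 2 / L := by
    rw [le_div_iff₀ hL0]
    linarith [sq_nonneg z]
  have hz2 : - z ^ 2 = - 1 + 2 * w - w ^ 2 := by rw [hzw]; ring
  rw [hz2]
  linarith

/-- For `l ≥ 165` and `z ∈ (0,1)`, `I(z)` is bounded by the cubic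
`-l³ + (6775346/41325)l² + (444/5)l`. -/
theorem stmt12 (l : ℕ) (hl : 165 ≤ l) (z : ℝ) (hz : z ∈ Set.Ioo (0:ℝ) 1) :
    Ifun l z < -(l:ℝ)^3 + (6775346/41325) * (l:ℝ)^2 + (444/5) * (l:ℝ) := by
  obtain ⟨hz0, hz1⟩ := hz
  have hL : (165:ℝ) ≤ l := by exact_mod_cast hl
  have hL0 : (0:ℝ) < l := by linarith
  have hw0 : 0 < 1 - z := by linarith
  have hy0 : 0 < z ^ (l - 1) := pow_pos hz0 _
  have hy1 : z ^ (l - 1) < 1 := pow_lt_one₀ hz0.le hz1 (by omega)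
  have hyz : z ^ (l - 1) ≤ z ^ 2 := pow_le_pow_of_le_one hz0.le hz1.le (by omega)
  have hLwy : (l:ℝ) * (1 - z) * z ^ (l - 1) ≤ 1.02 * z ^ 2 := by
    have h := pow_mul_one_add_mul_le_one hz0.le (l - 3)
    rw [Nat.cast_sub (by omega)] at h
    push_cast at h
    have hs : z ^ (l - 1) = z ^ 2 * z ^ (l - 3) := by rw [← pow_add]; congr 1; omega
    have hp : 0 < z ^ (l - 3) := pow_pos hz0 _
    have hq : 0 < z ^ (l - 3) * (1 - z) := by positivity
    have : (l:ℝ) * (1 - z) * z ^ (l - 3) ≤ 1.02 := by nlinarith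
    rw [hs]
    nlinarith [mul_le_mul_of_nonneg_left this (sq_nonneg z)]
  have hyw : 1 - z ^ (l - 1) ≤ l * (1 - z) := by
    have h := one_add_mul_le_pow (a := z - 1) (by linarith) (l - 1)
    rw [Nat.cast_sub (by omega), add_sub_cancel] at h
    push_cast at h
    nlinarith
  have hpow : z ^ l = z * z ^ (l - 1) := by rw [← pow_succ']; congr 1; omega
  have key := bracket_le hL hz0 hw0 (by ring) hy0.le hyz hLwy hyw rfl
  have hI : Ifun l z = (l:ℝ) ^ 3 / z ^ 2 * ((1 - z ^ (l - 1)) ^ 2 *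
      ((3 * z / l + 4 * (1 - z)) * z ^ (l - 1) - (1 - z)) ^ 3 / (1 - z)
      + 6 * (1 - z ^ (l - 1)) ^ 3 * ((3 * z / l + 4 * (1 - z)) * z ^ (l - 1) - (1 - z)) - 1
      + 8 * (1 - z) * (1 - z ^ (l - 1)) ^ 7) := by
    have hA : 0 + 3 * z ^ l / (l:ℝ) - (1 - z) * (1 - 4 * z ^ (l - 1))
        = (3 * z / l + 4 * (1 - z)) * z ^ (l - 1) - (1 - z) := by rw [hpow]; ring
    have hq : (1 - z ^ (l - 1)) ≠ 0 := by linarith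
    unfold Ifun Hfun
    rw [hA]
    generalize (3 * z / l + 4 * (1 - z)) * z ^ (l - 1) - (1 - z) = A
    generalize 1 - z ^ (l - 1) = q at hq
    rw [zpow_neg, show q ^ (2 : ℤ) = q ^ 2 from zpow_natCast q 2]
    field_simp
  rw [hI]
  calc _ ≤ (l:ℝ) ^ 3 / z ^ 2 * (- z ^ 2 + 80 * z ^ 2 / l) :=
        mul_le_mul_of_nonneg_left key (by positivity)
    _ = - (l:ℝ) ^ 3 + 80 * (l:ℝ) ^ 2 := by field_simp
    _ < _ := by nlinarith
end
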